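/- arXiv:1607.07556 — 2 statements merged into one kernel-verified Lean document; each statement's English description precedes it below -/
import Mathlib

section
/- Let s ≥ 0 and assume the CFL condition d τ K^2 ≤ c < 2π. Then there is a constant C, depending only on c, such that for all trigonometric polynomials v(x) = Σ_{j∈𝒦} v_j e^{i j·x} of degree K one has ‖(Ω^2 ϕ(iτΩ^2) + 1)^{−1} v‖_{s+2} ≤ C ‖v‖_s and ‖(Ω^2 + 1)^{−1} v − (Ω^2 ϕ(iτΩ^2) + 1)^{−1} v‖_s ≤ C τ ‖v‖_s. -/
noncomputable section

namespace Zak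

/-- Fourier coefficients of a function on the `d`-dimensional torus `𝕋^d`. -/
abbrev Coef (d : ℕ) := (Fin d → ℤ) → ℂ

/-- Euclidean norm `|j|` of a frequency `j ∈ ℤ^d`. -/
def absZ {d : ℕ} (j : Fin d → ℤ) : ℝ := Real.sqrt (∑ i, ((j i : ℝ)) ^ 2)

/-- Sobolev norm `‖v‖ₛ = (∑_j max(|j|,1)^{2s} |v_j|²)^{1/2}`. -/
def sobNorm {d : ℕ} (s : ℝ) (v : Coef d) : ℝ :=
  Real.sqrt (∑' j : Fin d → ℤ, (max (absZ j) 1) ^ (2 * s) * ‖v j‖ ^ 2)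

/-- Norm `|||(v, v̇)|||ₛ = (‖v‖_{s+1}² + ‖v̇‖ₛ²)^{1/2}` on `H^{s+1} × H^s`. -/
def pairNorm {d : ℕ} (s : ℝ) (v w : Coef d) : ℝ :=
  Real.sqrt (sobNorm (s + 1) v ^ 2 + sobNorm s w ^ 2)

/-- Convolution of Fourier coefficients (= product of the functions). -/
def conv {d : ℕ} (v w : Coef d) : Coef d := fun j => ∑' k : Fin d → ℤ, v k * w (j - k)

/-- Fourier coefficients of the complex conjugate function. -/
def conjC {d : ℕ} (v : Coef d) : Coef d := fun j => (starRingEnd ℂ) (v (-j))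

/-- Fourier coefficients of `|v|² = v ⬝ conj v`. -/
def absSq {d : ℕ} (v : Coef d) : Coef d := conv v (conjC v)

/-- Fourier coefficients of the real part of the function. -/
def reC {d : ℕ} (v : Coef d) : Coef d := fun j => (v j + (starRingEnd ℂ) (v (-j))) / 2

/-- Membership of a frequency in `𝒦 = {-K, …, K-1}^d`. -/
def inK (d K : ℕ) (j : Fin d → ℤ) : Prop := ∀ i, -(K : ℤ) ≤ j i ∧ j i < K

/-- Trigonometric polynomial of degree `K`: only modes in `𝒦` are present. -/
def isTrig (d K : ℕ) (v : Coef d) : Prop := ∀ j, ¬ inK d K j → v j = 0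

/-- The function is real-valued: conjugate-symmetric Fourier coefficients. -/
def isReal {d : ℕ} (v : Coef d) : Prop := ∀ j, v (-j) = (starRingEnd ℂ) (v j)

open Classical in
/-- Trigonometric interpolation `𝓘` of degree `K` at the collocation points
`x_k = kπ/K`, expressed through aliasing of Fourier coefficients. -/
def interp (d K : ℕ) (v : Coef d) : Coef d := fun j =>
  if inK d K j then ∑' m : Fin d → ℤ, v (j + (2 * (K : ℤ)) • m) else 0

/-- Fourier multiplier with symbol `g(|j|)`. -/
def mulOp {d : ℕ} (g : ℝ → ℂ) (v : Coef d) : Coef d := fun j => g (absZ j) * v j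

/-- `sinc ξ = sin ξ / ξ`, `sinc 0 = 1`. -/
def sinc (x : ℝ) : ℝ := if x = 0 then 1 else Real.sin x / x

/-- Convolution powers `v^{*n}` (with `v^{*0} = δ₀`). -/
def convPow {d : ℕ} (v : Coef d) : ℕ → Coef d
  | 0 => fun j => if j = 0 then 1 else 0
  | n + 1 => conv v (convPow v n)

/-- Composition with the exponential: Fourier coefficients of `e^{v}`. -/
def expC {d : ℕ} (v : Coef d) : Coef d :=
  fun j => ∑' n : ℕ, ((n.factorial : ℂ))⁻¹ * convPow v n j

/-- Composition with `ϕ(ξ) = (e^ξ - 1)/ξ = ∑ ξ^n/(n+1)!`. -/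
def phiC {d : ℕ} (v : Coef d) : Coef d :=
  fun j => ∑' n : ℕ, (((n + 1).factorial : ℂ))⁻¹ * convPow v n j

/-- The wave propagator matrix
`R(t) = [[cos(tΩ), t sinc(tΩ)], [-Ω sin(tΩ), cos(tΩ)]]`. -/
def Rop {d : ℕ} (t : ℝ) (p : Coef d × Coef d) : Coef d × Coef d :=
  (fun j => ((Real.cos (t * absZ j) : ℝ) : ℂ) * p.1 j
      + ((t * sinc (t * absZ j) : ℝ) : ℂ) * p.2 j,
   fun j => -(((absZ j * Real.sin (t * absZ j) : ℝ)) : ℂ) * p.1 j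
      + ((Real.cos (t * absZ j) : ℝ) : ℂ) * p.2 j)

/-- The operator `(Ω² ϕ(iτΩ²) + 1)⁻¹`, multiplying the `j`-th Fourier coefficient
by `iτ/(e^{iτ|j|²} - 1 + iτ)`. -/
def poissonInv (d : ℕ) (τ : ℝ) (v : Coef d) : Coef d :=
  fun j => (Complex.I * (τ : ℂ) /
      (Complex.exp (Complex.I * (τ : ℂ) * ((absZ j : ℝ) : ℂ) ^ 2) - 1 + Complex.I * (τ : ℂ))) * v j

/-- The operator `(Ω² + 1)⁻¹ = (-Δ + 1)⁻¹`. -/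
def laplInv (d : ℕ) (v : Coef d) : Coef d :=
  fun j => ((((absZ j) ^ 2 + 1 : ℝ)) : ℂ)⁻¹ * v j

/-- The free Schrödinger propagator `e^{-iτΩ²} = e^{iτΔ}`. -/
def freeOp {d : ℕ} (τ : ℝ) : Coef d → Coef d :=
  mulOp (fun x => Complex.exp (-Complex.I * (τ : ℂ) * ((x : ℂ)) ^ 2))

/-- The inverse free propagator `e^{iτΩ²}`. -/
def freeOpInv {d : ℕ} (τ : ℝ) : Coef d → Coef d :=
  mulOp (fun x => Complex.exp (Complex.I * (τ : ℂ) * ((x : ℂ)) ^ 2))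

/-- The operator `sinc(τΩ)`. -/
def sincOp {d : ℕ} (τ : ℝ) : Coef d → Coef d := mulOp (fun x => ((sinc (τ * x) : ℝ) : ℂ))

/-- The operator `sinc(τΩ/2)²`. -/
def sincHalfSqOp {d : ℕ} (τ : ℝ) : Coef d → Coef d :=
  mulOp (fun x => ((sinc (τ * x / 2) ^ 2 : ℝ) : ℂ))

/-- The operator `sinc(τΩ) - 1`. -/
def sincm1Op {d : ℕ} (τ : ℝ) : Coef d → Coef d := mulOp (fun x => ((sinc (τ * x) - 1 : ℝ) : ℂ))

/-- The Zakharov system in first-order form, `i∂_tψ = -Δψ + uψ`, `∂_t u = u̇`,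
`∂_t u̇ = Δu + Δ|ψ|²`, with `u`, `u̇` real-valued, formulated mode-wise for the
Fourier coefficients. -/
def ZakSol (d : ℕ) (ψ u ud : ℝ → Coef d) : Prop :=
  (∀ t j, HasDerivAt (fun r => ψ r j)
      (-Complex.I * (((absZ j ^ 2 : ℝ) : ℂ) * ψ t j + conv (u t) (ψ t) j)) t) ∧
  (∀ t j, HasDerivAt (fun r => u r j) (ud t j) t) ∧
  (∀ t j, HasDerivAt (fun r => ud r j)
      (-((absZ j ^ 2 : ℝ) : ℂ) * (u t j + absSq (ψ t) j)) t) ∧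
  (∀ t, isReal (u t)) ∧ (∀ t, isReal (ud t))

/-- The Fourier collocation semi-discretization in space of the Zakharov system:
`i∂_tψ^K = -Δψ^K + 𝓘(u^K ψ^K)`, `∂_t u^K = u̇^K`, `∂_t u̇^K = Δu^K + Δ𝓘(|ψ^K|²)`
for trigonometric polynomials of degree `K`. -/
def ZakSolK (d K : ℕ) (ψ u ud : ℝ → Coef d) : Prop :=
  (∀ t, isTrig d K (ψ t) ∧ isTrig d K (u t) ∧ isTrig d K (ud t)) ∧
  (∀ t j, HasDerivAt (fun r => ψ r j)
      (-Complex.I * (((absZ j ^ 2 : ℝ) : ℂ) * ψ t j + interp d K (conv (u t) (ψ t)) j)) t) ∧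
  (∀ t j, HasDerivAt (fun r => u r j) (ud t j) t) ∧
  (∀ t j, HasDerivAt (fun r => ud r j)
      (-((absZ j ^ 2 : ℝ) : ℂ) * (u t j + interp d K (absSq (ψ t)) j)) t)

/-- Interpolated initial values `ψ^K(t₀) = 𝓘(ψ(t₀))` etc. -/
def initK (d K : ℕ) (t₀ : ℝ) (ψ u ud ψK uK udK : ℝ → Coef d) : Prop :=
  ψK t₀ = interp d K (ψ t₀) ∧ uK t₀ = interp d K (u t₀) ∧ udK t₀ = interp d K (ud t₀)

/-- The new variable `φ = ∂_tψ`, expressed via the Schrödinger equation. -/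
def phiEx (d : ℕ) (ψ u : ℝ → Coef d) : ℝ → Coef d :=
  fun t j => -Complex.I * (((absZ j ^ 2 : ℝ) : ℂ) * ψ t j + conv (u t) (ψ t) j)

/-- The semi-discrete new variable `φ^K = ∂_tψ^K`, expressed via the semi-discrete
Schrödinger equation. -/
def phiK (d K : ℕ) (ψ u : ℝ → Coef d) : ℝ → Coef d :=
  fun t j => -Complex.I * (((absZ j ^ 2 : ℝ) : ℂ) * ψ t j + interp d K (conv (u t) (ψ t)) j)

/-- Regularity assumption `‖ψ(t)‖_{s+2+σ} + |||(u(t),u̇(t))|||_{s+σ} ≤ M` on `[t₀, t₀+T]`. -/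
def regBound (d : ℕ) (s σ M T t₀ : ℝ) (ψ u ud : ℝ → Coef d) : Prop :=
  ∀ t, t₀ ≤ t → t ≤ t₀ + T → sobNorm (s + 2 + σ) (ψ t) + pairNorm (s + σ) (u t) (ud t) ≤ M

/-- The CFL-type step-size restriction `d τ K² ≤ c`. -/
def CFL (d K : ℕ) (τ c : ℝ) : Prop := (d : ℝ) * τ * (K : ℝ) ^ 2 ≤ c

/-- The semi-discretization error quantity
`e(t) = sup_{t₀ ≤ t' ≤ t} (‖φ(t')-φ^K(t')‖ₛ + |||(u,u̇)(t') - (u^K,u̇^K)(t')|||ₛ)`. -/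
def errSemi (d K : ℕ) (s t₀ : ℝ) (ψ u ud ψK uK udK : ℝ → Coef d) (t : ℝ) : ℝ :=
  sSup ((fun r =>
    sobNorm s (phiEx d ψ u r - phiK d K ψK uK r)
      + pairNorm s (u r - uK r) (ud r - udK r)) '' Set.Icc t₀ t)

/-- `v_{n+1}^K = sinc(τΩ) u_n^K + (τ/2) sinc(τΩ/2)² u̇_n^K + (sinc(τΩ)-1) 𝓘(|ψ_n^K|²)`. -/
def vOrig (d K : ℕ) (τ : ℝ) (u ud ψ : Coef d) : Coef d :=
  sincOp τ u + ((τ / 2 : ℝ) : ℂ) • sincHalfSqOp τ ud + sincm1Op τ (interp d K (absSq ψ))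

/-- `ψ_{n+1}^K = e^{-iτΩ²} 𝓘(e^{-iτ v} ψ_n^K)`. -/
def psiStep (d K : ℕ) (τ : ℝ) (v ψ : Coef d) : Coef d :=
  freeOp τ (interp d K (conv (expC ((-Complex.I * (τ : ℂ)) • v)) ψ))

/-- `(u_{n+1}, u̇_{n+1}) = R(τ)(u_n, u̇_n) + (R(τ)-1)(q, 0)`. -/
def uStep {d : ℕ} (τ : ℝ) (u ud q : Coef d) : Coef d × Coef d :=
  ((Rop τ (u, ud)).1 + (Rop τ (q, 0)).1 - q, (Rop τ (u, ud)).2 + (Rop τ (q, 0)).2)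

/-- The Lie–Trotter splitting method of Jin, Markowich and Zheng. -/
def LieTrotter (d K : ℕ) (τ : ℝ) (ψn un udn : ℕ → Coef d) : Prop :=
  ∀ n : ℕ,
    ψn (n + 1) = psiStep d K τ (vOrig d K τ (un n) (udn n) (ψn n)) (ψn n) ∧
    un (n + 1) = (uStep τ (un n) (udn n) (interp d K (absSq (ψn n)))).1 ∧
    udn (n + 1) = (uStep τ (un n) (udn n) (interp d K (absSq (ψn n)))).2

/-- Interpolated starting values for the fully discrete method. -/
def initFull (d K : ℕ) (t₀ : ℝ) (ψ u ud : ℝ → Coef d) (ψn un udn : ℕ → Coef d) : Prop :=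
  ψn 0 = interp d K (ψ t₀) ∧ un 0 = interp d K (u t₀) ∧ udn 0 = interp d K (ud t₀)

/-- Discrete new variable `φ_n^K = (ψ_n^K - ψ_{n-1}^K)/τ`. -/
def phin {d : ℕ} (τ : ℝ) (ψn : ℕ → Coef d) (n : ℕ) : Coef d :=
  ((τ : ℂ))⁻¹ • (ψn n - ψn (n - 1))

/-- `v = sinc(τΩ) u - (τ/2) sinc(τΩ/2)² u̇ + (sinc(τΩ)-1) 𝓘(|p|²)` (new variables). -/
def vNew (d K : ℕ) (τ : ℝ) (u ud p : Coef d) : Coef d :=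
  sincOp τ u - ((τ / 2 : ℝ) : ℂ) • sincHalfSqOp τ ud + sincm1Op τ (interp d K (absSq p))

/-- `w = sinc(τΩ/2)² u̇ + (sinc(τΩ)-1) 𝓘(Re((p_cur + p_prev) conj φ))`. -/
def wNew (d K : ℕ) (τ : ℝ) (ud pcur pprev φ : Coef d) : Coef d :=
  sincHalfSqOp τ ud + sincm1Op τ (interp d K (reC (conv (pcur + pprev) (conjC φ))))

/-- One step of the method in the new variables:
`φ ↦ e^{-iτΩ²} 𝓘(e^{-iτv} (φ - iτ w ϕ(-iτ²w) p))`. -/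
def phiStepNew (d K : ℕ) (τ : ℝ) (v w φ p : Coef d) : Coef d :=
  freeOp τ (interp d K (conv (expC ((-Complex.I * (τ : ℂ)) • v))
    (φ - (Complex.I * (τ : ℂ)) • conv w (conv (phiC ((-Complex.I * (τ : ℂ) ^ 2) • w)) p))))

/-- `ψ_P = (Ω²ϕ(iτΩ²)+1)⁻¹ 𝓘(iφ + p - v ϕ(iτv) e^{iτΩ²} p)`. -/
def psiPNew (d K : ℕ) (τ : ℝ) (φ p v : Coef d) : Coef d :=
  poissonInv d τ (interp d K (Complex.I • φ + p -
    conv v (conv (phiC ((Complex.I * (τ : ℂ)) • v)) (freeOpInv τ p))))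

/-- Discrete new variable `v_n^K`. -/
def vn (d K : ℕ) (τ : ℝ) (ψn un udn : ℕ → Coef d) (n : ℕ) : Coef d :=
  vNew d K τ (un n) (udn n) (ψn (n - 1))

/-- Discrete new variable `w_n^K`. -/
def wn (d K : ℕ) (τ : ℝ) (ψn un udn : ℕ → Coef d) (n : ℕ) : Coef d :=
  wNew d K τ (udn n) (ψn n) (ψn (n - 1)) (phin τ ψn n)

/-- Discrete new variable `ψ_{P,n}^K` (with `ψ_{P,0}^K = ψ₀^K`). -/
def psiPn (d K : ℕ) (τ : ℝ) (ψn un udn : ℕ → Coef d) (n : ℕ) : Coef d :=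
  if n = 0 then ψn 0 else
    psiPNew d K τ (phin τ ψn n) (ψn n) (vn d K τ ψn un udn n)

/-- Intermediate quantity `ψ̂_{I,n}^K = ψ₀^K + τ(φ^K(t₁) + … + φ^K(t_n))`. -/
def psiIhat (d K : ℕ) (τ t₀ : ℝ) (ψK uK : ℝ → Coef d) (n : ℕ) : Coef d :=
  ψK t₀ + (τ : ℂ) • ∑ m ∈ Finset.range n, phiK d K ψK uK (t₀ + ((m : ℝ) + 1) * τ)

/-- Intermediate quantity `v̂_n^K`. -/
def vhat (d K : ℕ) (τ t₀ : ℝ) (ψK uK udK : ℝ → Coef d) (n : ℕ) : Coef d :=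
  vNew d K τ (uK (t₀ + (n : ℝ) * τ)) (udK (t₀ + (n : ℝ) * τ)) (psiIhat d K τ t₀ ψK uK (n - 1))

/-- Intermediate quantity `ŵ_n^K`. -/
def what (d K : ℕ) (τ t₀ : ℝ) (ψK uK udK : ℝ → Coef d) (n : ℕ) : Coef d :=
  wNew d K τ (udK (t₀ + (n : ℝ) * τ)) (psiIhat d K τ t₀ ψK uK n)
    (psiIhat d K τ t₀ ψK uK (n - 1)) (phiK d K ψK uK (t₀ + (n : ℝ) * τ))

/-- Intermediate quantity `φ̂_{n+1}^K` (as a function of `n`). -/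
def phihatSucc (d K : ℕ) (τ t₀ : ℝ) (ψK uK udK : ℝ → Coef d) (n : ℕ) : Coef d :=
  phiStepNew d K τ (vhat d K τ t₀ ψK uK udK n) (what d K τ t₀ ψK uK udK n)
    (phiK d K ψK uK (t₀ + (n : ℝ) * τ)) (psiIhat d K τ t₀ ψK uK n)

/-- Intermediate quantity `ψ̂_{P,n}^K` (with `ψ̂_{P,0}^K = ψ₀^K`). -/
def psiPhat (d K : ℕ) (τ t₀ : ℝ) (ψK uK udK : ℝ → Coef d) (n : ℕ) : Coef d :=
  if n = 0 then ψK t₀ else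
    psiPNew d K τ (phiK d K ψK uK (t₀ + (n : ℝ) * τ)) (psiIhat d K τ t₀ ψK uK n)
      (vhat d K τ t₀ ψK uK udK n)

/-- Intermediate quantity `(û_{n+1}^K, û̇_{n+1}^K)` (as a function of `n`). -/
def uhatSucc (d K : ℕ) (τ t₀ : ℝ) (ψK uK udK : ℝ → Coef d) (n : ℕ) : Coef d × Coef d :=
  uStep τ (uK (t₀ + (n : ℝ) * τ)) (udK (t₀ + (n : ℝ) * τ))
    (interp d K (absSq (psiPhat d K τ t₀ ψK uK udK n)))

/-- The fully discrete error quantity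
`e_n^K = max_{1 ≤ j ≤ n} (‖φ^K(t_j) - φ_j^K‖ₛ + |||(u^K,u̇^K)(t_j) - (u_j^K,u̇_j^K)|||ₛ)`,
with `e₀^K = 0`. -/
def errFull (d K : ℕ) (s τ t₀ : ℝ) (ψK uK udK : ℝ → Coef d)
    (ψn un udn : ℕ → Coef d) (n : ℕ) : ℝ :=
  sSup ((fun m : ℕ =>
    sobNorm s (phiK d K ψK uK (t₀ + (m : ℝ) * τ) - phin τ ψn m)
      + pairNorm s (uK (t₀ + (m : ℝ) * τ) - un m) (udK (t₀ + (m : ℝ) * τ) - udn m))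
    '' Set.Icc 1 n)

/-- Higher-order regularity bound on the semi-discrete solution (with constant `C₀`). -/
def regHighK (d K : ℕ) (s C₀ T t₀ : ℝ) (ψK uK udK : ℝ → Coef d) : Prop :=
  ∀ t, t₀ ≤ t → t ≤ t₀ + T →
    sobNorm (s + 4) (ψK t) + pairNorm (s + 2) (uK t) (udK t)
      + sobNorm (s + 2) (phiK d K ψK uK t) ≤ C₀

/-- A priori bound `‖φ_n^K‖ₛ + |||(u_n^K,u̇_n^K)|||ₛ ≤ B` for `τ ≤ t_n - t₀ ≤ T`
on the fully discrete solution. -/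
def aprioriFull {d : ℕ} (s B T τ : ℝ) (ψn un udn : ℕ → Coef d) : Prop :=
  ∀ n : ℕ, 1 ≤ n → (n : ℝ) * τ ≤ T →
    sobNorm s (phin τ ψn n) + pairNorm s (un n) (udn n) ≤ B

/-- Lower bound for the denominator. -/
theorem denom_lower (c : ℝ) (hc : c < 2 * Real.pi) :
    ∃ a : ℝ, 0 < a ∧ ∀ θ τ : ℝ, 0 ≤ θ → θ ≤ c → 0 < τ →
      a * θ ≤ ‖Complex.exp (Complex.I * (θ : ℂ)) - 1 + Complex.I * (τ : ℂ)‖ := by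
  have hpi := Real.pi_pos
  obtain ⟨σ, hσ⟩ : ∃ σ : ℝ, σ = 2 / Real.pi * (Real.pi - c / 2) := ⟨_, rfl⟩
  have hσpos : 0 < σ := by
    rw [hσ]
    exact mul_pos (by positivity) (by linarith)
  refine ⟨min (2 / Real.pi) (σ ^ 2 / Real.pi), lt_min (by positivity) (by positivity), ?_⟩
  intro θ τ hθ hθc hτ
  have hnsq : ‖Complex.exp (Complex.I * (θ : ℂ)) - 1 + Complex.I * (τ : ℂ)‖ ^ 2
      = 4 * Real.sin (θ / 2) ^ 2 + 4 * τ * Real.sin (θ / 2) * Real.cos (θ / 2) + τ ^ 2 := by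
    have h1 : Complex.exp (Complex.I * (θ : ℂ)) = (Real.cos θ : ℂ) + (Real.sin θ : ℂ) * Complex.I := by
      rw [mul_comm, Complex.exp_mul_I, Complex.ofReal_cos, Complex.ofReal_sin]
    have h2 : Complex.exp (Complex.I * (θ : ℂ)) - 1 + Complex.I * (τ : ℂ)
        = ((Real.cos θ - 1 : ℝ) : ℂ) + ((Real.sin θ + τ : ℝ) : ℂ) * Complex.I := by
      rw [h1]; push_cast; ring
    rw [h2, ← Complex.normSq_eq_norm_sq, Complex.normSq_add_mul_I]
    have hc2 : Real.cos θ = 2 * Real.cos (θ / 2) ^ 2 - 1 := by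
      rw [← Real.cos_two_mul]; congr 1; ring
    have hs2 : Real.sin θ = 2 * Real.sin (θ / 2) * Real.cos (θ / 2) := by
      rw [← Real.sin_two_mul]; congr 1; ring
    have hsc := Real.sin_sq_add_cos_sq (θ / 2)
    rw [hc2, hs2]
    have hcc : Real.cos (θ / 2) ^ 2 = 1 - Real.sin (θ / 2) ^ 2 := by linarith
    have : (2 * Real.sin (θ / 2) * Real.cos (θ / 2) + τ) ^ 2
      = 4 * Real.sin (θ / 2) ^ 2 * Real.cos (θ / 2) ^ 2
        + 4 * τ * Real.sin (θ / 2) * Real.cos (θ / 2) + τ ^ 2 := by ring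
    rw [this, hcc]; ring
  have hn0 := norm_nonneg (Complex.exp (Complex.I * (θ : ℂ)) - 1 + Complex.I * (τ : ℂ))
  have hS0 : 0 ≤ Real.sin (θ / 2) :=
    Real.sin_nonneg_of_nonneg_of_le_pi (by linarith) (by linarith)
  rcases le_total (θ / 2) (Real.pi / 2) with h | h
  · have hC0 : 0 ≤ Real.cos (θ / 2) :=
      Real.cos_nonneg_of_neg_pi_div_two_le_of_le (by linarith) h
    have hS : 2 / Real.pi * (θ / 2) ≤ Real.sin (θ / 2) := Real.mul_le_sin (by linarith) h
    have hle : 2 * Real.sin (θ / 2)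
        ≤ ‖Complex.exp (Complex.I * (θ : ℂ)) - 1 + Complex.I * (τ : ℂ)‖ := by
      apply le_of_sq_le_sq _ hn0
      rw [hnsq]
      have : 0 ≤ 4 * τ * Real.sin (θ / 2) * Real.cos (θ / 2) := by positivity
      nlinarith [sq_nonneg τ]
    calc _ ≤ 2 / Real.pi * θ := by gcongr; exact min_le_left _ _
      _ = 2 * (2 / Real.pi * (θ / 2)) := by ring
      _ ≤ _ := by linarith
  · have hS : σ ≤ Real.sin (θ / 2) := by
      have h3 := Real.mul_le_sin (x := Real.pi - θ / 2) (by linarith) (by linarith)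
      rw [Real.sin_pi_sub] at h3
      refine le_trans ?_ h3
      rw [hσ]
      gcongr
    have hle : 2 * Real.sin (θ / 2) ^ 2
        ≤ ‖Complex.exp (Complex.I * (θ : ℂ)) - 1 + Complex.I * (τ : ℂ)‖ := by
      apply le_of_sq_le_sq _ hn0
      rw [hnsq]
      have hsc := Real.sin_sq_add_cos_sq (θ / 2)
      have h4 : Real.sin (θ / 2) ^ 2 * Real.cos (θ / 2) ^ 2
        = Real.sin (θ / 2) ^ 2 - Real.sin (θ / 2) ^ 4 := by
        rw [show Real.cos (θ / 2) ^ 2 = 1 - Real.sin (θ / 2) ^ 2 by linarith]; ring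
      nlinarith [sq_nonneg (τ + 2 * Real.sin (θ / 2) * Real.cos (θ / 2))]
    have hσs : σ ^ 2 ≤ Real.sin (θ / 2) ^ 2 := by gcongr
    calc _ ≤ σ ^ 2 / Real.pi * θ := by gcongr; exact min_le_right _ _
      _ ≤ σ ^ 2 / Real.pi * (2 * Real.pi) := by gcongr; linarith
      _ = 2 * σ ^ 2 := by field_simp
      _ ≤ _ := by linarith

/-- Second-order Taylor bound for the exponential on the imaginary axis. -/
theorem exp_taylor (θ : ℝ) (hθ : 0 ≤ θ) :
    ‖Complex.exp (Complex.I * (θ : ℂ)) - 1 - Complex.I * (θ : ℂ)‖ ≤ 3 * θ ^ 2 := by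
  have hn : ‖Complex.I * (θ : ℂ)‖ = θ := by
    rw [norm_mul, Complex.norm_I, one_mul, Complex.norm_real, Real.norm_of_nonneg hθ]
  rcases le_total θ 1 with h | h
  · have := Complex.norm_exp_sub_one_sub_id_le (x := Complex.I * (θ : ℂ)) (by rw [hn]; exact h)
    rw [hn] at this
    nlinarith [sq_nonneg θ]
  · have h1 : ‖Complex.exp (Complex.I * (θ : ℂ))‖ = 1 := by
      rw [mul_comm]; exact Complex.norm_exp_ofReal_mul_I θ
    have h2 := norm_sub_le (Complex.exp (Complex.I * (θ : ℂ)) - 1) (Complex.I * (θ : ℂ))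
    have h3 := norm_sub_le (Complex.exp (Complex.I * (θ : ℂ))) 1
    rw [h1, norm_one] at h3
    rw [hn] at h2
    nlinarith

theorem finite_inK (d K : ℕ) : {j : Fin d → ℤ | inK d K j}.Finite := by
  apply (Set.finite_Icc (fun _ : Fin d => -(K : ℤ)) (fun _ => (K : ℤ))).subset
  intro j hj
  exact ⟨fun i => (hj i).1, fun i => (hj i).2.le⟩

/-- Comparison of Sobolev norms from a modewise comparison. -/
theorem sobNorm_le {d K : ℕ} (s s' B : ℝ) (hB : 0 ≤ B) (v w : Coef d) (hv : isTrig d K v)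
    (hw : isTrig d K w)
    (h : ∀ j, inK d K j → (max (absZ j) 1) ^ (2 * s') * ‖w j‖ ^ 2
      ≤ B ^ 2 * ((max (absZ j) 1) ^ (2 * s) * ‖v j‖ ^ 2)) :
    sobNorm s' w ≤ B * sobNorm s v := by
  have summ : ∀ (r : ℝ) (u : Coef d), isTrig d K u →
      Summable (fun j : Fin d → ℤ => (max (absZ j) 1) ^ (2 * r) * ‖u j‖ ^ 2) := by
    intro r u hu
    apply summable_of_hasFiniteSupport
    apply (finite_inK d K).subset
    intro j hj
    by_contra hjk
    exact hj (by simp [hu j hjk])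
  unfold sobNorm
  have hBs : B = Real.sqrt (B ^ 2) := (Real.sqrt_sq hB).symm
  conv_rhs => rw [hBs]
  rw [← Real.sqrt_mul (sq_nonneg B), ← tsum_mul_left]
  apply Real.sqrt_le_sqrt
  apply Summable.tsum_le_tsum _ (summ s' w hw) ((summ s v hv).mul_left _)
  intro j
  by_cases hj : inK d K j
  · exact h j hj
  · simp [hv j hj, hw j hj]

theorem absZ_sq {d : ℕ} (j : Fin d → ℤ) : absZ j ^ 2 = ∑ i, ((j i : ℝ)) ^ 2 :=
  Real.sq_sqrt (Finset.sum_nonneg fun _ _ => sq_nonneg _)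

theorem absZ_sq_le {d K : ℕ} (j : Fin d → ℤ) (hj : inK d K j) :
    absZ j ^ 2 ≤ d * (K : ℝ) ^ 2 := by
  rw [absZ_sq]
  calc ∑ i, ((j i : ℝ)) ^ 2 ≤ ∑ _i : Fin d, (K : ℝ) ^ 2 := by
        apply Finset.sum_le_sum
        intro i _
        apply sq_le_sq'
        · exact_mod_cast (hj i).1
        · exact_mod_cast (hj i).2.le
    _ = _ := by simp

theorem absZ_cases {d : ℕ} (j : Fin d → ℤ) : absZ j = 0 ∨ 1 ≤ absZ j := by
  by_cases h : j = 0
  · left; simp [h, absZ]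
  · right
    obtain ⟨i, hi⟩ := Function.ne_iff.mp h
    apply Real.one_le_sqrt.mpr
    have h1 : (1 : ℝ) ≤ ((j i : ℝ)) ^ 2 := by
      have : (1 : ℤ) ≤ (j i) ^ 2 := by
        have : 0 < (j i) ^ 2 := by
          have : j i ≠ 0 := hi
          positivity
        omega
      exact_mod_cast this
    exact h1.trans (Finset.single_le_sum (f := fun i => ((j i : ℝ)) ^ 2)
      (fun _ _ => sq_nonneg _) (Finset.mem_univ i))

/-- Bounds for the Fourier symbols. -/
theorem symbol_bounds (a : ℝ) (ha : 0 < a) (τ : ℝ) (hτ : 0 < τ) (x : ℝ)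
    (hx : x = 0 ∨ 1 ≤ x)
    (hD : a * (τ * x ^ 2) ≤ ‖Complex.exp (Complex.I * ((τ * x ^ 2 : ℝ) : ℂ)) - 1
      + Complex.I * (τ : ℂ)‖) :
    (max x 1) ^ 2 * ‖Complex.I * (τ : ℂ) /
      (Complex.exp (Complex.I * (τ : ℂ) * ((x : ℝ) : ℂ) ^ 2) - 1 + Complex.I * (τ : ℂ))‖
        ≤ 1 + 3 / a ∧
    ‖((x ^ 2 + 1 : ℝ) : ℂ)⁻¹ - Complex.I * (τ : ℂ) /
      (Complex.exp (Complex.I * (τ : ℂ) * ((x : ℝ) : ℂ) ^ 2) - 1 + Complex.I * (τ : ℂ))‖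
        ≤ (1 + 3 / a) * τ := by
  have h3a : 0 < 3 / a := by positivity
  have hIτ : Complex.I * (τ : ℂ) ≠ 0 :=
    mul_ne_zero Complex.I_ne_zero (by exact_mod_cast hτ.ne')
  rcases hx with rfl | hx
  · constructor
    · simp [hτ.ne']; linarith
    · simp [hτ.ne']; positivity
  · have hx2 : (1 : ℝ) ≤ x ^ 2 := by nlinarith
    have e : Complex.I * (τ : ℂ) * ((x : ℝ) : ℂ) ^ 2 = Complex.I * ((τ * x ^ 2 : ℝ) : ℂ) := by
      push_cast; ring
    rw [e]
    have hT := exp_taylor (τ * x ^ 2) (by positivity)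
    obtain ⟨E, hE⟩ : ∃ E, E = Complex.exp (Complex.I * ((τ * x ^ 2 : ℝ) : ℂ)) := ⟨_, rfl⟩
    rw [← hE] at hD hT ⊢
    have hDpos : 0 < ‖E - 1 + Complex.I * (τ : ℂ)‖ := lt_of_lt_of_le (by positivity) hD
    have hDne : E - 1 + Complex.I * (τ : ℂ) ≠ 0 := norm_pos_iff.mp hDpos
    have hnτ : ‖Complex.I * (τ : ℂ)‖ = τ := by
      rw [norm_mul, Complex.norm_I, one_mul, Complex.norm_real, Real.norm_of_nonneg hτ.le]
    constructor
    · rw [max_eq_left hx, norm_div, hnτ, ← mul_div_assoc, div_le_iff₀ hDpos]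
      calc x ^ 2 * τ = (1 / a) * (a * (τ * x ^ 2)) := by field_simp
        _ ≤ (1 / a) * ‖E - 1 + Complex.I * (τ : ℂ)‖ := by gcongr
        _ ≤ _ := by
          gcongr
          have : 3 / a = 3 * (1 / a) := by ring
          have : 0 < 1 / a := by positivity
          linarith
    · have hne : ((x ^ 2 + 1 : ℝ) : ℂ) ≠ 0 := by
        have : x ^ 2 + 1 ≠ 0 := by positivity
        exact_mod_cast this
      have heq : ((x ^ 2 + 1 : ℝ) : ℂ)⁻¹ - Complex.I * (τ : ℂ) / (E - 1 + Complex.I * (τ : ℂ))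
          = (E - 1 - Complex.I * ((τ * x ^ 2 : ℝ) : ℂ)) /
            (((x ^ 2 + 1 : ℝ) : ℂ) * (E - 1 + Complex.I * (τ : ℂ))) := by
        rw [inv_eq_one_div, div_sub_div _ _ hne hDne]
        congr 1
        push_cast; ring
      rw [heq, norm_div, norm_mul, Complex.norm_real, Real.norm_of_nonneg (by positivity),
        div_le_iff₀ (by positivity)]
      calc _ ≤ 3 * (τ * x ^ 2) ^ 2 := hT
        _ = (3 / a) * τ * (x ^ 2 * (a * (τ * x ^ 2))) := by field_simp
        _ ≤ (1 + 3 / a) * τ * ((x ^ 2 + 1) * ‖E - 1 + Complex.I * (τ : ℂ)‖) := by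
          gcongr <;> linarith

/-- **Lemma (regularity gain of the discrete Poisson-type operator).**
Under the CFL condition `d τ K² ≤ c < 2π` one has, for trigonometric polynomials `v`
of degree `K` and all `s ≥ 0`,
`‖(Ω²ϕ(iτΩ²)+1)⁻¹ v‖_{s+2} ≤ C ‖v‖_s` and
`‖(Ω²+1)⁻¹ v - (Ω²ϕ(iτΩ²)+1)⁻¹ v‖_s ≤ C τ ‖v‖_s`, with `C` depending only on `c`. -/
theorem poisson_operator_bounds (c : ℝ) (hc : c < 2 * Real.pi) :
    ∃ C : ℝ, ∀ s : ℝ, 0 ≤ s → ∀ (d K : ℕ), 1 ≤ d → ∀ τ : ℝ, 0 < τ →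
      CFL d K τ c →
      ∀ v : Coef d, isTrig d K v →
        sobNorm (s + 2) (poissonInv d τ v) ≤ C * sobNorm s v ∧
        sobNorm s (laplInv d v - poissonInv d τ v) ≤ C * τ * sobNorm s v := by
  obtain ⟨a, ha, hlow⟩ := denom_lower c hc
  refine ⟨1 + 3 / a, ?_⟩
  intro s hs d K hd τ hτ hcfl v hv
  have hC : 0 ≤ 1 + 3 / a := by positivity
  have key := fun (j : Fin d → ℤ) (hj : inK d K j) =>
    symbol_bounds a ha τ hτ (absZ j) (absZ_cases j)
      (hlow (τ * absZ j ^ 2) τ (by positivity) (by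
        have h1 := mul_le_mul_of_nonneg_left (absZ_sq_le j hj) hτ.le
        have h2 : (d : ℝ) * τ * (K : ℝ) ^ 2 ≤ c := hcfl
        nlinarith) hτ)
  constructor
  · apply sobNorm_le (K := K) s (s + 2) _ hC v _ hv
    · intro j hj
      simp [poissonInv, hv j hj]
    · intro j hj
      have h1 := (key j hj).1
      have hm : 0 < max (absZ j) 1 := lt_of_lt_of_le one_pos (le_max_right _ _)
      have hsplit : (max (absZ j) 1) ^ (2 * (s + 2))
          = (max (absZ j) 1) ^ (2 * s) * ((max (absZ j) 1) ^ 2) ^ 2 := by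
        rw [show 2 * (s + 2) = 2 * s + ((4 : ℕ) : ℝ) by push_cast; ring,
          Real.rpow_add hm, Real.rpow_natCast]
        ring
      have hp : 0 ≤ (max (absZ j) 1) ^ (2 * s) := by positivity
      rw [hsplit, poissonInv, norm_mul]
      have h2 := pow_le_pow_left₀ (by positivity) h1 2
      have h3 := mul_le_mul_of_nonneg_right h2
        (mul_nonneg hp (sq_nonneg ‖v j‖))
      refine le_trans (le_of_eq ?_) h3
      ring
  · apply sobNorm_le (K := K) s s _ (by positivity) v _ hv
    · intro j hj
      simp [poissonInv, laplInv, hv j hj]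
    · intro j hj
      have h1 := (key j hj).2
      have hp : 0 ≤ (max (absZ j) 1) ^ (2 * s) := by positivity
      rw [Pi.sub_apply, poissonInv, laplInv, ← sub_mul, norm_mul]
      have h2 := pow_le_pow_left₀ (norm_nonneg _) h1 2
      have h3 := mul_le_mul_of_nonneg_right h2
        (mul_nonneg hp (sq_nonneg ‖v j‖))
      refine le_trans (le_of_eq ?_) h3
      ring

end Zak
end
end

section
/- Let s > d/2 and σ ≥ 2, assume the exact solution of the Zakharov system satisfies ‖ψ(t)‖_{s+2+σ} + |||(u(t),u̇(t))|||_{s+σ} ≤ M for 0 ≤ t−t₀ ≤ T with M ≥ 1, and assume the a priori bound ‖φ_n^K‖_s + |||(u_n^K,u̇_n^K)|||_s ≤ 2C₀M on the fully discrete solution for τ ≤ t_n−t₀ ≤ T. Then there is a constant C, depending only on d, s, σ, M, T and c, such that for τ ≤ t_n−t₀ ≤ T one has ‖v̂_n^K − v_n^K‖_s ≤ C e_n^K and ‖ŵ_n^K − w_n^K‖_s ≤ C e_n^K. -/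
noncomputable section

namespace Zak

/-! ### Helper material for the proof -/

/-- The weight `max(|j|,1)^{2s}`. -/
def wt {d : ℕ} (s : ℝ) (j : Fin d → ℤ) : ℝ := (max (absZ j) 1) ^ (2 * s)

/-- The cube of frequencies with `|j_i| ≤ N`. -/
def cube (d N : ℕ) : Finset (Fin d → ℤ) := Fintype.piFinset (fun _ => Finset.Icc (-(N : ℤ)) N)

lemma mem_cube {d N : ℕ} {j : Fin d → ℤ} : j ∈ cube d N ↔ ∀ i, -(N : ℤ) ≤ j i ∧ j i ≤ N := by
  simp [cube, Fintype.mem_piFinset]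

/-- Fourier support in the cube of size `N`. -/
def Sup (N : ℕ) {d : ℕ} (v : Coef d) : Prop := ∀ j, j ∉ cube d N → v j = 0

lemma wt_pos {d : ℕ} (s : ℝ) (j : Fin d → ℤ) : 0 < wt s j := by
  unfold wt; positivity

lemma absZ_nonneg {d : ℕ} (j : Fin d → ℤ) : 0 ≤ absZ j := Real.sqrt_nonneg _

lemma absZ_eq_norm {d : ℕ} (j : Fin d → ℤ) :
    absZ j = ‖(WithLp.toLp 2 (fun i => (j i : ℝ)) : EuclideanSpace ℝ (Fin d))‖ := by
  simp [absZ, EuclideanSpace.norm_eq]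

lemma absZ_add_le {d : ℕ} (j k : Fin d → ℤ) : absZ (j + k) ≤ absZ j + absZ k := by
  rw [absZ_eq_norm, absZ_eq_norm, absZ_eq_norm]
  refine le_trans (le_of_eq ?_) (norm_add_le _ _)
  congr 1
  ext i
  simp

lemma absZ_neg {d : ℕ} (j : Fin d → ℤ) : absZ (-j) = absZ j := by
  simp [absZ]

lemma wt_neg {d : ℕ} (s : ℝ) (j : Fin d → ℤ) : wt s (-j) = wt s j := by
  simp [wt, absZ_neg]

lemma wt_mono {d : ℕ} {s s' : ℝ} (h : s ≤ s') (j : Fin d → ℤ) : wt s j ≤ wt s' j := by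
  unfold wt
  exact Real.rpow_le_rpow_of_exponent_le (le_max_right _ _) (by linarith)

lemma wt_le_of_absZ {d : ℕ} {s : ℝ} (hs : 0 ≤ s) {j k : Fin d → ℤ} (h : absZ j ≤ absZ k) :
    wt s j ≤ wt s k := by
  unfold wt
  exact Real.rpow_le_rpow (by positivity) (max_le_max_right _ h) (by linarith)

lemma wt_add {d : ℕ} {s : ℝ} (hs : 0 ≤ s) (j k : Fin d → ℤ) :
    wt s (j + k) ≤ 2 ^ (2 * s) * (wt s j + wt s k) := by
  wlog h : absZ j ≤ absZ k generalizing j k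
  · rw [add_comm j k, add_comm (wt s j)]
    exact this k j (le_of_lt (not_le.mp h))
  have h1 : max (absZ (j + k)) 1 ≤ 2 * max (absZ k) 1 := by
    apply max_le
    · have := absZ_add_le j k
      have := le_max_left (absZ k) 1
      linarith
    · have := le_max_right (absZ k) 1
      linarith
  calc wt s (j + k) ≤ (2 * max (absZ k) 1) ^ (2 * s) :=
        Real.rpow_le_rpow (by positivity) h1 (by linarith)
    _ = 2 ^ (2 * s) * wt s k := by
        rw [Real.mul_rpow (by norm_num) (by positivity)]; rfl
    _ ≤ _ := by
        have := wt_pos s j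
        gcongr
        linarith

lemma summable_wt {d : ℕ} {s : ℝ} (hs : (d : ℝ) / 2 < s) :
    Summable (fun j : Fin d → ℤ => (wt s j)⁻¹) := by
  let b := (EuclideanSpace.basisFun (Fin d) ℝ).toBasis
  let L := Submodule.span ℤ (Set.range b)
  have hL : Module.finrank ℤ L = d := by
    rw [ZLattice.rank ℝ L]; simp
  have h1 := ZLattice.summable_norm_rpow L (-(2 * s)) (by rw [hL]; linarith)
  have hmem : ∀ j : Fin d → ℤ,
      (WithLp.toLp 2 (fun i => (j i : ℝ)) : EuclideanSpace ℝ (Fin d)) ∈ L := by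
    intro j
    rw [Module.Basis.mem_span_iff_repr_mem]
    intro i
    exact ⟨j i, by simp [b]⟩
  let f : (Fin d → ℤ) → L := fun j => ⟨_, hmem j⟩
  have hf : Function.Injective f := by
    intro j k h
    have h2 := congrArg (fun z : L => (z : EuclideanSpace ℝ (Fin d))) h
    funext i
    have h3 := congrArg (fun z : EuclideanSpace ℝ (Fin d) => z i) h2
    simpa [f] using h3
  have h2 := h1.comp_injective hf
  have h3 : Summable (fun j : Fin d → ℤ => if j = 0 then (1 : ℝ) else 0) := by
    apply summable_of_ne_finset_zero (s := {0})
    intro j hj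
    simp at hj
    simp [hj]
  refine Summable.of_nonneg_of_le (fun j => (inv_pos.mpr (wt_pos s j)).le) (fun j => ?_)
    (h2.add h3)
  have h4 : ((fun z : L => ‖z‖ ^ (-(2 * s))) ∘ f) j = (absZ j) ^ (-(2 * s)) := by
    simp only [Function.comp, f, absZ_eq_norm]
    rfl
  have hs0 : 0 < s := lt_of_le_of_lt (by positivity) hs
  rw [h4]
  by_cases hj : j = 0
  · subst hj
    have : absZ (0 : Fin d → ℤ) = 0 := by simp [absZ]
    simp [this, wt]
    positivity
  · have hp : 0 < absZ j := by
      rw [absZ_eq_norm, norm_pos_iff]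
      intro h
      apply hj
      funext i
      have h3 := congrArg (fun z : EuclideanSpace ℝ (Fin d) => z i) h
      simpa using h3
    simp only [hj, if_false, add_zero, wt]
    rw [Real.rpow_neg hp.le]
    gcongr
    exact le_max_left _ _

/-! Sobolev norms of trigonometric polynomials. -/

lemma sobNorm_nonneg {d : ℕ} (s : ℝ) (v : Coef d) : 0 ≤ sobNorm s v := Real.sqrt_nonneg _

lemma summable_sob {d N : ℕ} (s : ℝ) {v : Coef d} (hv : Sup N v) :
    Summable (fun j => wt s j * ‖v j‖ ^ 2) := by
  apply summable_of_ne_finset_zero (s := cube d N)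
  intro j hj
  simp [hv j hj]

lemma sobNorm_sq_tsum {d : ℕ} (s : ℝ) (v : Coef d) :
    sobNorm s v ^ 2 = ∑' j, wt s j * ‖v j‖ ^ 2 := by
  unfold sobNorm
  rw [Real.sq_sqrt]
  · rfl
  · exact tsum_nonneg fun j => mul_nonneg (wt_pos s j).le (by positivity)

lemma sobNorm_sq {d N : ℕ} (s : ℝ) {v : Coef d} (hv : Sup N v) :
    sobNorm s v ^ 2 = ∑ j ∈ cube d N, wt s j * ‖v j‖ ^ 2 := by
  rw [sobNorm_sq_tsum]
  apply tsum_eq_sum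
  intro j hj
  simp [hv j hj]

/-- Weighted coefficient vector. -/
def EV (d N : ℕ) (s : ℝ) (v : Coef d) : EuclideanSpace ℂ (cube d N) :=
  WithLp.toLp 2 (fun j => ((Real.sqrt (wt s j.1) : ℝ) : ℂ) * v j.1)

lemma sobNorm_eq_EV {d N : ℕ} (s : ℝ) {v : Coef d} (hv : Sup N v) :
    sobNorm s v = ‖EV d N s v‖ := by
  rw [← Real.sqrt_sq (sobNorm_nonneg s v), sobNorm_sq s hv, EuclideanSpace.norm_eq,
    ← Finset.sum_coe_sort]
  congr 1
  apply Finset.sum_congr rfl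
  intro j _
  simp only [EV, norm_mul, mul_pow, Complex.norm_real, Real.norm_eq_abs, sq_abs]
  rw [Real.sq_sqrt (wt_pos s j.1).le]

lemma Sup.add {d N : ℕ} {v w : Coef d} (hv : Sup N v) (hw : Sup N w) : Sup N (v + w) := by
  intro j hj; simp [hv j hj, hw j hj]

lemma Sup.sub {d N : ℕ} {v w : Coef d} (hv : Sup N v) (hw : Sup N w) : Sup N (v - w) := by
  intro j hj; simp [hv j hj, hw j hj]

lemma Sup.smul {d N : ℕ} {v : Coef d} (c : ℂ) (hv : Sup N v) : Sup N (c • v) := by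
  intro j hj; simp [hv j hj]

lemma Sup.zero {d N : ℕ} : Sup N (0 : Coef d) := fun _ _ => rfl

lemma Sup.sum {d N : ℕ} {ι : Type*} (t : Finset ι) (f : ι → Coef d) (h : ∀ i ∈ t, Sup N (f i)) :
    Sup N (∑ i ∈ t, f i) := by
  intro j hj
  rw [Finset.sum_apply]
  exact Finset.sum_eq_zero fun i hi => h i hi j hj

lemma sobNorm_add_le {d N : ℕ} (s : ℝ) {v w : Coef d} (hv : Sup N v) (hw : Sup N w) :
    sobNorm s (v + w) ≤ sobNorm s v + sobNorm s w := by
  rw [sobNorm_eq_EV s hv, sobNorm_eq_EV s hw, sobNorm_eq_EV s (hv.add hw)]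
  refine le_trans (le_of_eq ?_) (norm_add_le _ _)
  congr 1
  ext j
  simp [EV, mul_add]

lemma sobNorm_smul {d : ℕ} (s : ℝ) (c : ℂ) (v : Coef d) :
    sobNorm s (c • v) = ‖c‖ * sobNorm s v := by
  rw [← Real.sqrt_sq (sobNorm_nonneg s (c • v)), sobNorm_sq_tsum]
  have : ∀ j, wt s j * ‖(c • v) j‖ ^ 2 = ‖c‖ ^ 2 * (wt s j * ‖v j‖ ^ 2) := by
    intro j; simp [mul_pow]; ring
  simp_rw [this]
  rw [tsum_mul_left, ← sobNorm_sq_tsum, ← mul_pow,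
    Real.sqrt_sq (mul_nonneg (norm_nonneg _) (sobNorm_nonneg _ _))]

lemma sobNorm_zero {d : ℕ} (s : ℝ) : sobNorm s (0 : Coef d) = 0 := by
  simp [sobNorm]

lemma sobNorm_sub_le {d N : ℕ} (s : ℝ) {v w : Coef d} (hv : Sup N v) (hw : Sup N w) :
    sobNorm s (v - w) ≤ sobNorm s v + sobNorm s w := by
  have h := sobNorm_add_le s hv (hw.smul (-1))
  rw [sobNorm_smul] at h
  simpa [sub_eq_add_neg] using h

lemma sobNorm_sum_le {d N : ℕ} (s : ℝ) {ι : Type*} (t : Finset ι) (f : ι → Coef d)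
    (h : ∀ i, Sup N (f i)) :
    sobNorm s (∑ i ∈ t, f i) ≤ ∑ i ∈ t, sobNorm s (f i) := by
  classical
  induction t using Finset.induction_on with
  | empty => simp [sobNorm_zero]
  | insert a t ha ih =>
    rw [Finset.sum_insert ha, Finset.sum_insert ha]
    have := sobNorm_add_le s (h a) (Sup.sum t f fun i _ => h i)
    linarith

lemma sobNorm_le_of {d N N' : ℕ} {s s' c : ℝ} (hc : 0 ≤ c) {a b : Coef d} (ha : Sup N a)
    (hb : Sup N' b) (e : (Fin d → ℤ) ≃ (Fin d → ℤ))
    (h : ∀ j, wt s j * ‖a j‖ ^ 2 ≤ c ^ 2 * (wt s' (e j) * ‖b (e j)‖ ^ 2)) :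
    sobNorm s a ≤ c * sobNorm s' b := by
  apply le_of_sq_le_sq _ (mul_nonneg hc (sobNorm_nonneg _ _))
  rw [mul_pow, sobNorm_sq_tsum, sobNorm_sq_tsum,
    ← e.tsum_eq (fun j => wt s' j * ‖b j‖ ^ 2), ← tsum_mul_left]
  exact Summable.tsum_le_tsum h (summable_sob s ha)
    (((e.summable_iff (f := fun j => wt s' j * ‖b j‖ ^ 2)).mpr (summable_sob s' hb)).mul_left _)

lemma conv_eq_sum {d N : ℕ} {v : Coef d} (hv : Sup N v) (w : Coef d) (j : Fin d → ℤ) :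
    conv v w j = ∑ k ∈ cube d N, v k * w (j - k) := by
  unfold conv
  apply tsum_eq_sum
  intro k hk
  simp [hv k hk]

lemma Sup.conv {d N M : ℕ} {v w : Coef d} (hv : Sup N v) (hw : Sup M w) :
    Sup (N + M) (conv v w) := by
  intro j hj
  rw [conv_eq_sum hv]
  apply Finset.sum_eq_zero
  intro k hk
  rw [hw, mul_zero]
  intro h
  apply hj
  rw [mem_cube] at *
  intro i
  have h1 := h i
  have h2 := hk i
  simp only [Pi.sub_apply] at h1
  push_cast
  omega

lemma Sup.conjC {d N : ℕ} {v : Coef d} (hv : Sup N v) : Sup N (conjC v) := by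
  intro j hj
  unfold Zak.conjC
  rw [hv, map_zero]
  intro h
  apply hj
  rw [mem_cube] at *
  intro i
  have := h i
  simp only [Pi.neg_apply] at this
  omega

lemma Sup.mono {d N M : ℕ} (h : N ≤ M) {v : Coef d} (hv : Sup N v) : Sup M v := by
  intro j hj
  apply hv
  intro h2
  apply hj
  rw [mem_cube] at *
  intro i
  have := h2 i
  omega

lemma Sup.reC {d N : ℕ} {v : Coef d} (hv : Sup N v) : Sup N (reC v) := by
  intro j hj
  have h1 := hv.conjC j hj
  unfold Zak.conjC at h1
  unfold Zak.reC
  rw [h1, hv j hj]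
  simp

lemma sobNorm_conjC {d N : ℕ} (s : ℝ) {v : Coef d} (hv : Sup N v) :
    sobNorm s (conjC v) ≤ sobNorm s v := by
  have := sobNorm_le_of (s := s) (s' := s) (zero_le_one) hv.conjC hv (Equiv.neg _) (by
    intro j
    simp [conjC, wt_neg])
  simpa using this

lemma sobNorm_reC {d N : ℕ} (s : ℝ) {v : Coef d} (hv : Sup N v) :
    sobNorm s (reC v) ≤ sobNorm s v := by
  have h : reC v = (1 / 2 : ℂ) • (v + conjC v) := by
    funext j
    simp [reC, conjC]
    ring
  rw [h, sobNorm_smul]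
  have h1 := sobNorm_add_le s hv hv.conjC
  have h2 := sobNorm_conjC s hv
  norm_num
  linarith

lemma sobNorm_mulOp {d N : ℕ} (s : ℝ) {c : ℝ} (hc : 0 ≤ c) {g : ℝ → ℂ} (hg : ∀ x, ‖g x‖ ≤ c)
    {v : Coef d} (hv : Sup N v) : sobNorm s (mulOp g v) ≤ c * sobNorm s v := by
  have hs : Sup N (mulOp g v) := by
    intro j hj; simp [mulOp, hv j hj]
  refine sobNorm_le_of hc hs hv (Equiv.refl _) ?_
  intro j
  simp only [mulOp, norm_mul, mul_pow, Equiv.refl_apply]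
  have h1 := hg (absZ j)
  have h2 : ‖g (absZ j)‖ ^ 2 ≤ c ^ 2 := by gcongr
  have h3 : 0 ≤ wt s j * ‖v j‖ ^ 2 := mul_nonneg (wt_pos s j).le (by positivity)
  nlinarith

lemma sobNorm_mono {d N : ℕ} {s s' : ℝ} (h : s ≤ s') {v : Coef d} (hv : Sup N v) :
    sobNorm s v ≤ sobNorm s' v := by
  have := sobNorm_le_of (s := s) (s' := s') (zero_le_one) hv hv (Equiv.refl _) (by
    intro j
    have := wt_mono h j
    simp only [Equiv.refl_apply, one_pow, one_mul]
    gcongr)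
  simpa using this

/-- The constant in the algebra property of `H^s`. -/
def algC (d : ℕ) (s : ℝ) : ℝ := 2 ^ (2 * s) * (2 * ∑' j : Fin d → ℤ, (wt s j)⁻¹)

lemma algC_nonneg (d : ℕ) (s : ℝ) : 0 ≤ algC d s := by
  unfold algC
  have : 0 ≤ ∑' j : Fin d → ℤ, (wt s j)⁻¹ :=
    tsum_nonneg fun j => (inv_pos.mpr (wt_pos s j)).le
  positivity

lemma kernel_bound {d : ℕ} {s : ℝ} (hs : (d : ℝ) / 2 < s) (N : ℕ) (j : Fin d → ℤ) :
    ∑ k ∈ cube d N, wt s j / (wt s k * wt s (j - k)) ≤ algC d s := by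
  have hs0 : 0 ≤ s := (lt_of_le_of_lt (by positivity) hs).le
  have hsum := summable_wt hs
  have hpos : ∀ k : Fin d → ℤ, 0 ≤ (wt s k)⁻¹ := fun k => (inv_pos.mpr (wt_pos s k)).le
  have h1 : ∑ k ∈ cube d N, (wt s k)⁻¹ ≤ ∑' k : Fin d → ℤ, (wt s k)⁻¹ :=
    hsum.sum_le_tsum _ fun k _ => hpos k
  have hsum2 : Summable (fun k : Fin d → ℤ => (wt s (j - k))⁻¹) :=
    ((Equiv.subLeft j).summable_iff (f := fun k : Fin d → ℤ => (wt s k)⁻¹)).mpr hsum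
  have h2 : ∑ k ∈ cube d N, (wt s (j - k))⁻¹ ≤ ∑' k : Fin d → ℤ, (wt s k)⁻¹ := by
    rw [← (Equiv.subLeft j).tsum_eq (fun k : Fin d → ℤ => (wt s k)⁻¹)]
    exact hsum2.sum_le_tsum _ fun k _ => hpos _
  calc ∑ k ∈ cube d N, wt s j / (wt s k * wt s (j - k))
      ≤ ∑ k ∈ cube d N, 2 ^ (2 * s) * ((wt s k)⁻¹ + (wt s (j - k))⁻¹) := by
        apply Finset.sum_le_sum
        intro k _
        have ha := wt_pos s k
        have hb := wt_pos s (j - k)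
        have h := wt_add hs0 k (j - k)
        rw [add_sub_cancel] at h
        rw [div_le_iff₀ (by positivity)]
        refine h.trans (le_of_eq ?_)
        field_simp
        ring
    _ = 2 ^ (2 * s) * (∑ k ∈ cube d N, (wt s k)⁻¹ + ∑ k ∈ cube d N, (wt s (j - k))⁻¹) := by
        rw [← Finset.mul_sum, Finset.sum_add_distrib]
    _ ≤ _ := by
        unfold algC
        gcongr
        linarith

lemma conv_pointwise {d N : ℕ} {s : ℝ} (hs : (d : ℝ) / 2 < s) {v : Coef d} (w : Coef d)
    (hv : Sup N v) (j : Fin d → ℤ) :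
    wt s j * ‖conv v w j‖ ^ 2 ≤ algC d s *
      ∑ k ∈ cube d N, (wt s k * ‖v k‖ ^ 2) * (wt s (j - k) * ‖w (j - k)‖ ^ 2) := by
  have hj := wt_pos s j
  have hg : ∀ k ∈ cube d N, 0 < wt s j / (wt s k * wt s (j - k)) := by
    intro k _
    have ha := wt_pos s k
    have hb := wt_pos s (j - k)
    positivity
  have hne : (cube d N).Nonempty := ⟨0, by rw [mem_cube]; simp⟩
  have h1 := Finset.sq_sum_div_le_sum_sq_div (cube d N) (fun k => ‖v k‖ * ‖w (j - k)‖) hg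
  have hG := Finset.sum_pos hg hne
  rw [div_le_iff₀ hG] at h1
  have h2 : ‖conv v w j‖ ≤ ∑ k ∈ cube d N, ‖v k‖ * ‖w (j - k)‖ := by
    rw [conv_eq_sum hv]
    refine (norm_sum_le _ _).trans (le_of_eq ?_)
    simp
  have h3 : ‖conv v w j‖ ^ 2 ≤ (∑ k ∈ cube d N, ‖v k‖ * ‖w (j - k)‖) ^ 2 := by gcongr
  have h4 : wt s j * ∑ k ∈ cube d N, (‖v k‖ * ‖w (j - k)‖) ^ 2 / (wt s j / (wt s k * wt s (j - k)))
      = ∑ k ∈ cube d N, (wt s k * ‖v k‖ ^ 2) * (wt s (j - k) * ‖w (j - k)‖ ^ 2) := by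
    rw [Finset.mul_sum]
    apply Finset.sum_congr rfl
    intro k _
    have ha := wt_pos s k
    have hb := wt_pos s (j - k)
    field_simp
  have h5 : 0 ≤ ∑ k ∈ cube d N, (wt s k * ‖v k‖ ^ 2) * (wt s (j - k) * ‖w (j - k)‖ ^ 2) := by
    apply Finset.sum_nonneg
    intro k _
    have ha := wt_pos s k
    have hb := wt_pos s (j - k)
    positivity
  have h6 := mul_le_mul_of_nonneg_left (h3.trans h1) hj.le
  rw [← mul_assoc, h4, mul_comm _ (∑ k ∈ cube d N, wt s j / (wt s k * wt s (j - k)))] at h6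
  exact h6.trans (mul_le_mul_of_nonneg_right (kernel_bound hs N j) h5)

lemma sobNorm_conv {d N M : ℕ} {s : ℝ} (hs : (d : ℝ) / 2 < s) {v w : Coef d}
    (hv : Sup N v) (hw : Sup M w) :
    sobNorm s (conv v w) ≤ Real.sqrt (algC d s) * (sobNorm s v * sobNorm s w) := by
  apply le_of_sq_le_sq _ (mul_nonneg (Real.sqrt_nonneg _)
    (mul_nonneg (sobNorm_nonneg _ _) (sobNorm_nonneg _ _)))
  rw [mul_pow, mul_pow, Real.sq_sqrt (algC_nonneg d s), sobNorm_sq s (hv.conv hw)]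
  calc ∑ j ∈ cube d (N + M), wt s j * ‖conv v w j‖ ^ 2
      ≤ ∑ j ∈ cube d (N + M), algC d s *
      ∑ k ∈ cube d N, (wt s k * ‖v k‖ ^ 2) * (wt s (j - k) * ‖w (j - k)‖ ^ 2) :=
        Finset.sum_le_sum fun j _ => conv_pointwise hs w hv j
    _ = algC d s * ∑ k ∈ cube d N, (wt s k * ‖v k‖ ^ 2) *
          ∑ j ∈ cube d (N + M), (wt s (j - k) * ‖w (j - k)‖ ^ 2) := by
        rw [← Finset.mul_sum, Finset.sum_comm]
        simp_rw [Finset.mul_sum]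
    _ ≤ algC d s * ∑ k ∈ cube d N, (wt s k * ‖v k‖ ^ 2) * sobNorm s w ^ 2 := by
        refine mul_le_mul_of_nonneg_left (Finset.sum_le_sum fun k _ => ?_) (algC_nonneg d s)
        refine mul_le_mul_of_nonneg_left ?_ (mul_nonneg (wt_pos s k).le (by positivity))
        rw [sobNorm_sq_tsum, ← (Equiv.subRight k).tsum_eq (fun j => wt s j * ‖w j‖ ^ 2)]
        exact (((Equiv.subRight k).summable_iff (f := fun j => wt s j * ‖w j‖ ^ 2)).mpr
          (summable_sob s hw)).sum_le_tsum _
            fun j _ => mul_nonneg (wt_pos s _).le (by positivity)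
    _ = _ := by
        rw [← Finset.sum_mul, ← sobNorm_sq s hv]

/-! Trigonometric interpolation. -/

lemma inK_cube {d K : ℕ} {j : Fin d → ℤ} (h : inK d K j) : j ∈ cube d K := by
  rw [mem_cube]
  intro i
  have := h i
  omega

lemma isTrig.sup {d K : ℕ} {v : Coef d} (h : isTrig d K v) : Sup K v := by
  intro j hj
  exact h j fun h2 => hj (inK_cube h2)

lemma isTrig_interp (d K : ℕ) (v : Coef d) : isTrig d K (interp d K v) := by
  intro j hj
  simp [interp, hj]

lemma interp_zero_deg {d : ℕ} (hd : 1 ≤ d) (v : Coef d) : interp d 0 v = 0 := by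
  funext j
  have : ¬ inK d 0 j := by
    intro h
    have := h ⟨0, hd⟩
    simp at this
    omega
  simp [interp, this]

open Classical in
/-- One aliasing term of the interpolation. -/
def foldTerm (d K : ℕ) (m : Fin d → ℤ) (v : Coef d) : Coef d := fun j =>
  if inK d K j then v (j + (2 * (K : ℤ)) • m) else 0

lemma interp_eq_sum {d K : ℕ} (hK : 1 ≤ K) {v : Coef d} (hv : Sup (2 * K) v) :
    interp d K v = ∑ m ∈ cube d 1, foldTerm d K m v := by
  funext j
  rw [Finset.sum_apply]
  by_cases hj : inK d K j
  · simp only [interp, foldTerm, hj, if_true]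
    apply tsum_eq_sum
    intro m hm
    apply hv
    intro h
    apply hm
    rw [mem_cube] at *
    intro i
    have h1 := h i
    have h2 := hj i
    simp only [Pi.add_apply, Pi.smul_apply, smul_eq_mul] at h1
    push_cast at h1
    have hK' : (1 : ℤ) ≤ K := by exact_mod_cast hK
    push_cast
    constructor
    · by_contra hc
      have : m i ≤ -2 := by omega
      nlinarith
    · by_contra hc
      have : 2 ≤ m i := by omega
      nlinarith
  · simp [interp, foldTerm, hj]

lemma absZ_fold {d K : ℕ} {j : Fin d → ℤ} (hj : inK d K j) (m : Fin d → ℤ) :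
    absZ j ≤ absZ (j + (2 * (K : ℤ)) • m) := by
  unfold absZ
  apply Real.sqrt_le_sqrt
  apply Finset.sum_le_sum
  intro i _
  have h2 := hj i
  have : (j i) ^ 2 ≤ ((j + (2 * (K : ℤ)) • m) i) ^ 2 := by
    simp only [Pi.add_apply, Pi.smul_apply, smul_eq_mul]
    have hK : (0 : ℤ) ≤ K := by positivity
    rcases lt_trichotomy (m i) 0 with h | h | h
    · have h3 : m i ≤ -1 := by omega
      have h4 : 2 * (K : ℤ) * m i ≤ - (2 * K) := by nlinarith
      nlinarith
    · simp [h]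
    · have h3 : 1 ≤ m i := by omega
      have h4 : 2 * (K : ℤ) ≤ 2 * (K : ℤ) * m i := by nlinarith
      nlinarith
  exact_mod_cast this

lemma sobNorm_fold {d K : ℕ} {s : ℝ} (hs : 0 ≤ s) (m : Fin d → ℤ) {v : Coef d}
    {N : ℕ} (hv : Sup N v) :
    sobNorm s (foldTerm d K m v) ≤ sobNorm s v := by
  have h0 : Sup K (foldTerm d K m v) := by
    intro j hj
    have : ¬ inK d K j := fun h => hj (inK_cube h)
    simp [foldTerm, this]
  have := sobNorm_le_of (s := s) (s' := s) (zero_le_one) h0 hv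
    (Equiv.addRight ((2 * (K : ℤ)) • m)) (by
    intro j
    by_cases hj : inK d K j
    · have h1 := wt_le_of_absZ hs (absZ_fold hj m)
      simp only [foldTerm, hj, if_true, Equiv.coe_addRight, one_pow, one_mul]
      gcongr
    · have := wt_pos s (j + (2 * (K : ℤ)) • m)
      simp only [foldTerm, hj, if_false, Equiv.coe_addRight, one_pow, one_mul]
      simp
      positivity)
  simpa using this

lemma sobNorm_interp {d K : ℕ} (hd : 1 ≤ d) {s : ℝ} (hs : 0 ≤ s) {v : Coef d}
    (hv : Sup (2 * K) v) :
    sobNorm s (interp d K v) ≤ (cube d 1).card * sobNorm s v := by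
  rcases Nat.eq_zero_or_pos K with rfl | hK
  · rw [interp_zero_deg hd, sobNorm_zero]
    exact mul_nonneg (Nat.cast_nonneg _) (sobNorm_nonneg _ _)
  · rw [interp_eq_sum hK hv]
    refine (sobNorm_sum_le (N := K) s _ _ ?_).trans ?_
    · intro m j hj
      have : ¬ inK d K j := fun h => hj (inK_cube h)
      simp [foldTerm, this]
    · refine (Finset.sum_le_sum fun m _ => sobNorm_fold hs m hv).trans ?_
      simp

lemma interp_sub {d K : ℕ} (hd : 1 ≤ d) {v w : Coef d} (hv : Sup (2 * K) v) (hw : Sup (2 * K) w) :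
    interp d K (v - w) = interp d K v - interp d K w := by
  rcases Nat.eq_zero_or_pos K with rfl | hK
  · simp [interp_zero_deg hd]
  · rw [interp_eq_sum hK hv, interp_eq_sum hK hw, interp_eq_sum hK (hv.sub hw),
      ← Finset.sum_sub_distrib]
    apply Finset.sum_congr rfl
    intro m _
    funext j
    by_cases hj : inK d K j <;> simp [foldTerm, hj]

lemma conv_diff {d N : ℕ} {a b x y : Coef d} (ha : Sup N a) (hb : Sup N b) :
    conv a x - conv b y = conv (a - b) x + conv b (x - y) := by
  funext j
  simp only [Pi.sub_apply, Pi.add_apply]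
  rw [conv_eq_sum ha, conv_eq_sum hb, conv_eq_sum hb, conv_eq_sum (ha.sub hb),
    ← Finset.sum_sub_distrib, ← Finset.sum_add_distrib]
  apply Finset.sum_congr rfl
  intro k _
  simp only [Pi.sub_apply]
  ring

lemma conjC_sub {d : ℕ} (a b : Coef d) : conjC (a - b) = conjC a - conjC b := by
  funext j; simp [conjC]

lemma reC_sub {d : ℕ} (a b : Coef d) : reC (a - b) = reC a - reC b := by
  funext j; simp [reC]; ring

lemma mulOp_sub {d : ℕ} (g : ℝ → ℂ) (a b : Coef d) : mulOp g (a - b) = mulOp g a - mulOp g b := by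
  funext j; simp [mulOp]; ring

/-- The key bilinear difference estimate. -/
lemma sob_bilin_diff {d K : ℕ} {s : ℝ} (hs : (d : ℝ) / 2 < s)
    {a b x y : Coef d} (ha : Sup K a) (hb : Sup K b) (hx : Sup K x) (hy : Sup K y) :
    sobNorm s (conv a (conjC x) - conv b (conjC y)) ≤
      Real.sqrt (algC d s) * (sobNorm s (a - b) * sobNorm s x + sobNorm s b * sobNorm s (x - y)) := by
  rw [conv_diff ha hb, ← conjC_sub]
  have h1 := sobNorm_add_le s ((ha.sub hb).conv hx.conjC) (hb.conv (hx.sub hy).conjC)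
  have h2 := sobNorm_conv hs (ha.sub hb) hx.conjC
  have h3 := sobNorm_conv hs hb (hx.sub hy).conjC
  have h4 := sobNorm_conjC s hx
  have h5 := sobNorm_conjC s (hx.sub hy)
  have h6 : sobNorm s (a - b) * sobNorm s (conjC x) ≤ sobNorm s (a - b) * sobNorm s x :=
    mul_le_mul_of_nonneg_left h4 (sobNorm_nonneg _ _)
  have h7 : sobNorm s b * sobNorm s (conjC (x - y)) ≤ sobNorm s b * sobNorm s (x - y) :=
    mul_le_mul_of_nonneg_left h5 (sobNorm_nonneg _ _)
  have h8 := mul_le_mul_of_nonneg_left h6 (Real.sqrt_nonneg (algC d s))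
  have h9 := mul_le_mul_of_nonneg_left h7 (Real.sqrt_nonneg (algC d s))
  rw [mul_add]
  linarith

/-- The constant for interpolated products. -/
def bC (d : ℕ) (s : ℝ) : ℝ := (cube d 1).card * Real.sqrt (algC d s)

lemma bC_nonneg (d : ℕ) (s : ℝ) : 0 ≤ bC d s :=
  mul_nonneg (Nat.cast_nonneg _) (Real.sqrt_nonneg _)

lemma sob_interp_diff {d K : ℕ} (hd : 1 ≤ d) {s : ℝ} (hs : (d : ℝ) / 2 < s)
    {a b x y : Coef d} (ha : Sup K a) (hb : Sup K b) (hx : Sup K x) (hy : Sup K y) :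
    sobNorm s (interp d K (conv a (conjC x)) - interp d K (conv b (conjC y))) ≤
      bC d s * (sobNorm s (a - b) * sobNorm s x + sobNorm s b * sobNorm s (x - y)) := by
  have hs0 : 0 ≤ s := (lt_of_le_of_lt (by positivity) hs).le
  have e : K + K = 2 * K := by ring
  have h1 := e ▸ ha.conv hx.conjC
  have h2 := e ▸ hb.conv hy.conjC
  rw [← interp_sub hd h1 h2]
  refine (sobNorm_interp hd hs0 (h1.sub h2)).trans ?_
  rw [bC, mul_assoc]
  exact mul_le_mul_of_nonneg_left (sob_bilin_diff hs ha hb hx hy) (Nat.cast_nonneg _)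

lemma sob_interp_re_diff {d K : ℕ} (hd : 1 ≤ d) {s : ℝ} (hs : (d : ℝ) / 2 < s)
    {a b x y : Coef d} (ha : Sup K a) (hb : Sup K b) (hx : Sup K x) (hy : Sup K y) :
    sobNorm s (interp d K (reC (conv a (conjC x))) - interp d K (reC (conv b (conjC y)))) ≤
      bC d s * (sobNorm s (a - b) * sobNorm s x + sobNorm s b * sobNorm s (x - y)) := by
  have hs0 : 0 ≤ s := (lt_of_le_of_lt (by positivity) hs).le
  have e : K + K = 2 * K := by ring
  have h1 := e ▸ ha.conv hx.conjC
  have h2 := e ▸ hb.conv hy.conjC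
  rw [← interp_sub hd h1.reC h2.reC, ← reC_sub]
  refine (sobNorm_interp hd hs0 (h1.sub h2).reC).trans ?_
  rw [bC, mul_assoc]
  exact mul_le_mul_of_nonneg_left
    ((sobNorm_reC s (h1.sub h2)).trans (sob_bilin_diff hs ha hb hx hy)) (Nat.cast_nonneg _)

/-! The sinc filters. -/

lemma abs_sinc_le (x : ℝ) : |sinc x| ≤ 1 := by
  have : sinc x = Real.sinc x := by simp [sinc, Real.sinc]
  rw [this]; exact Real.abs_sinc_le_one x

lemma sob_sincOp {d N : ℕ} (s τ : ℝ) {v : Coef d} (hv : Sup N v) :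
    sobNorm s (sincOp τ v) ≤ sobNorm s v := by
  have := sobNorm_mulOp s zero_le_one (g := fun x => ((sinc (τ * x) : ℝ) : ℂ))
    (fun x => by rw [Complex.norm_real]; exact abs_sinc_le _) hv
  simpa [sincOp] using this

lemma sob_sincHalfSqOp {d N : ℕ} (s τ : ℝ) {v : Coef d} (hv : Sup N v) :
    sobNorm s (sincHalfSqOp τ v) ≤ sobNorm s v := by
  have := sobNorm_mulOp s zero_le_one (g := fun x => ((sinc (τ * x / 2) ^ 2 : ℝ) : ℂ))
    (fun x => by
      rw [Complex.norm_real, norm_pow]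
      exact pow_le_one₀ (norm_nonneg _) (abs_sinc_le _)) hv
  rw [one_mul] at this
  exact this

lemma sob_sincm1Op {d N : ℕ} (s τ : ℝ) {v : Coef d} (hv : Sup N v) :
    sobNorm s (sincm1Op τ v) ≤ 2 * sobNorm s v := by
  exact sobNorm_mulOp s zero_le_two (g := fun x => ((sinc (τ * x) - 1 : ℝ) : ℂ))
    (fun x => by
      rw [Complex.norm_real, Real.norm_eq_abs]
      have := abs_le.mp (abs_sinc_le (τ * x))
      rw [abs_le]
      constructor <;> linarith) hv

lemma Sup.mulOp {d N : ℕ} (g : ℝ → ℂ) {v : Coef d} (hv : Sup N v) : Sup N (mulOp g v) := by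
  intro j hj; simp [Zak.mulOp, hv j hj]

lemma pairNorm_nonneg {d : ℕ} (s : ℝ) (v w : Coef d) : 0 ≤ pairNorm s v w := Real.sqrt_nonneg _

lemma le_pairNorm_left {d : ℕ} (s : ℝ) (v w : Coef d) : sobNorm (s + 1) v ≤ pairNorm s v w := by
  apply Real.le_sqrt_of_sq_le
  have := sq_nonneg (sobNorm s w)
  linarith

lemma le_pairNorm_right {d : ℕ} (s : ℝ) (v w : Coef d) : sobNorm s w ≤ pairNorm s v w := by
  apply Real.le_sqrt_of_sq_le
  have := sq_nonneg (sobNorm (s + 1) v)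
  linarith

lemma sup_phiK {d K : ℕ} {ψ u : ℝ → Coef d} (h : ∀ t, Sup K (ψ t)) (t : ℝ) :
    Sup K (phiK d K ψ u t) := by
  intro j hj
  have h1 := (isTrig_interp d K (conv (u t) (ψ t))).sup j hj
  simp [phiK, h t j hj, h1]

lemma sup_uStep {d N : ℕ} (τ : ℝ) {u ud q : Coef d} (hu : Sup N u) (hud : Sup N ud)
    (hq : Sup N q) : Sup N (uStep τ u ud q).1 ∧ Sup N (uStep τ u ud q).2 := by
  constructor
  · intro j hj
    simp [uStep, Rop, hu j hj, hud j hj, hq j hj]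
  · intro j hj
    simp [uStep, Rop, hu j hj, hud j hj, hq j hj]

lemma sup_full {d K : ℕ} {τ t₀ : ℝ} {ψ u ud : ℝ → Coef d} {ψn un udn : ℕ → Coef d}
    (hLT : LieTrotter d K τ ψn un udn) (hi : initFull d K t₀ ψ u ud ψn un udn) :
    (∀ m, Sup K (ψn m)) ∧ (∀ m, Sup K (un m)) ∧ (∀ m, Sup K (udn m)) := by
  have h : ∀ m, Sup K (ψn m) ∧ Sup K (un m) ∧ Sup K (udn m) := by
    intro m
    induction m with
    | zero =>
      rw [hi.1, hi.2.1, hi.2.2]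
      exact ⟨(isTrig_interp d K _).sup, (isTrig_interp d K _).sup, (isTrig_interp d K _).sup⟩
    | succ m ih =>
      obtain ⟨h1, h2, h3⟩ := hLT m
      have h4 := sup_uStep τ ih.2.1 ih.2.2 (isTrig_interp d K (absSq (ψn m))).sup
      rw [h1, h2, h3, psiStep, freeOp]
      exact ⟨Sup.mulOp _ (isTrig_interp d K _).sup, h4.1, h4.2⟩
  exact ⟨fun m => (h m).1, fun m => (h m).2.1, fun m => (h m).2.2⟩

lemma psi_tele {d : ℕ} {τ : ℝ} (hτ : τ ≠ 0) (ψn : ℕ → Coef d) (m : ℕ) :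
    ψn m = ψn 0 + (τ : ℂ) • ∑ i ∈ Finset.range m, phin τ ψn (i + 1) := by
  have hc : (τ : ℂ) ≠ 0 := by exact_mod_cast hτ
  induction m with
  | zero => simp
  | succ m ih =>
    rw [Finset.sum_range_succ, smul_add, ← add_assoc, ← ih, phin, smul_inv_smul₀ hc]
    simp

/-- **Lemma (stability in `v` and `w`).** Under the regularity and a priori bounds,
`‖v̂_n^K - v_n^K‖ₛ ≤ C e_n^K` and `‖ŵ_n^K - w_n^K‖ₛ ≤ C e_n^K` for `τ ≤ t_n - t₀ ≤ T`. -/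
theorem stability_vw (d : ℕ) (hd : 1 ≤ d) (s σ M T c C₀ : ℝ)
    (hs : (d : ℝ) / 2 < s) (hσ : 2 ≤ σ) (hM : 1 ≤ M) (hT : 0 < T)
    (hc : c < 2 * Real.pi) :
    ∃ C : ℝ, ∀ (K : ℕ) (τ : ℝ), 0 < τ →
      ∀ (ψ u ud ψK uK udK : ℝ → Coef d) (ψn un udn : ℕ → Coef d) (t₀ : ℝ),
        ZakSol d ψ u ud →
        regBound d s σ M T t₀ ψ u ud →
        ZakSolK d K ψK uK udK →
        initK d K t₀ ψ u ud ψK uK udK →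
        regHighK d K s C₀ T t₀ ψK uK udK →
        LieTrotter d K τ ψn un udn →
        initFull d K t₀ ψ u ud ψn un udn →
        aprioriFull s (2 * C₀ * M) T τ ψn un udn →
        ∀ n : ℕ, 1 ≤ n → (n : ℝ) * τ ≤ T →
          sobNorm s (vhat d K τ t₀ ψK uK udK n - vn d K τ ψn un udn n)
              ≤ C * errFull d K s τ t₀ ψK uK udK ψn un udn n ∧
          sobNorm s (what d K τ t₀ ψK uK udK n - wn d K τ ψn un udn n)
              ≤ C * errFull d K s τ t₀ ψK uK udK ψn un udn n := by
  refine ⟨1 + T / 2 + 2 * bC d s * (2 * T * (C₀ + T * (2 * C₀ * M)) + 2 * T * C₀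
    + 2 * (C₀ + T * (2 * C₀ * M))), ?_⟩
  intro K τ hτ ψ u ud ψK uK udK ψn un udn t₀ _ _ hK hiK hreg hLT hiF hap n hn hnT
  obtain ⟨htrig, -, -, -⟩ := hK
  -- supports
  have sψK : ∀ t, Sup K (ψK t) := fun t => (htrig t).1.sup
  have suK : ∀ t, Sup K (uK t) := fun t => (htrig t).2.1.sup
  have sudK : ∀ t, Sup K (udK t) := fun t => (htrig t).2.2.sup
  have sφK : ∀ t, Sup K (phiK d K ψK uK t) := sup_phiK sψK
  have sI : ∀ v, Sup K (interp d K v) := fun v => (isTrig_interp d K v).sup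
  obtain ⟨sψn, sun, sudn⟩ := sup_full hLT hiF
  have sφn : ∀ m, Sup K (phin τ ψn m) := fun m => ((sψn m).sub (sψn (m - 1))).smul _
  have sI2 : ∀ m, Sup K (psiIhat d K τ t₀ ψK uK m) := fun m =>
    (sψK t₀).add ((Sup.sum _ _ fun i _ => sφK _).smul _)
  -- error bounds
  set ε := errFull d K s τ t₀ ψK uK udK ψn un udn n with hε
  have herr : ∀ m : ℕ, 1 ≤ m → m ≤ n →
      sobNorm s (phiK d K ψK uK (t₀ + (m : ℝ) * τ) - phin τ ψn m)
      + pairNorm s (uK (t₀ + (m : ℝ) * τ) - un m) (udK (t₀ + (m : ℝ) * τ) - udn m) ≤ ε := by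
    intro m h1 h2
    rw [hε]
    unfold errFull
    exact le_csSup ((Set.finite_Icc 1 n).image _).bddAbove ⟨m, ⟨h1, h2⟩, rfl⟩
  have hφe : ∀ m : ℕ, 1 ≤ m → m ≤ n →
      sobNorm s (phiK d K ψK uK (t₀ + (m : ℝ) * τ) - phin τ ψn m) ≤ ε := by
    intro m h1 h2
    have := herr m h1 h2
    have := pairNorm_nonneg s (uK (t₀ + (m : ℝ) * τ) - un m) (udK (t₀ + (m : ℝ) * τ) - udn m)
    linarith
  have hpe : pairNorm s (uK (t₀ + (n : ℝ) * τ) - un n) (udK (t₀ + (n : ℝ) * τ) - udn n) ≤ ε := by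
    have := herr n hn le_rfl
    have := sobNorm_nonneg s (phiK d K ψK uK (t₀ + (n : ℝ) * τ) - phin τ ψn n)
    linarith
  have hue : sobNorm s (uK (t₀ + (n : ℝ) * τ) - un n) ≤ ε :=
    ((sobNorm_mono (by linarith) ((suK _).sub (sun n))).trans (le_pairNorm_left _ _ _)).trans hpe
  have hude : sobNorm s (udK (t₀ + (n : ℝ) * τ) - udn n) ≤ ε :=
    (le_pairNorm_right _ _ _).trans hpe
  have hε0 : 0 ≤ ε := (sobNorm_nonneg _ _).trans hue
  have hmT : ∀ m : ℕ, m ≤ n → (m : ℝ) * τ ≤ T := by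
    intro m hm
    refine le_trans ?_ hnT
    gcongr
  have hτT : τ ≤ T := by simpa using hmT 1 hn
  -- size bounds
  have hφb : ∀ t, t₀ ≤ t → t ≤ t₀ + T → sobNorm s (phiK d K ψK uK t) ≤ C₀ := by
    intro t h1 h2
    have h3 := hreg t h1 h2
    have h4 := sobNorm_nonneg (s + 4) (ψK t)
    have h5 := pairNorm_nonneg (s + 2) (uK t) (udK t)
    have h6 := sobNorm_mono (s := s) (s' := s + 2) (by linarith) (sφK t)
    linarith
  have hψ0 : sobNorm s (ψK t₀) ≤ C₀ := by
    have h3 := hreg t₀ le_rfl (by linarith)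
    have h4 := sobNorm_nonneg (s + 2) (phiK d K ψK uK t₀)
    have h5 := pairNorm_nonneg (s + 2) (uK t₀) (udK t₀)
    have h6 := sobNorm_mono (s := s) (s' := s + 4) (by linarith) (sψK t₀)
    linarith
  have hC0 : 0 ≤ C₀ := (sobNorm_nonneg _ _).trans hψ0
  have h00 : ψK t₀ = ψn 0 := by rw [hiK.1, hiF.1]
  have htele : ∀ m, ψn m = ψn 0 + (τ : ℂ) • ∑ i ∈ Finset.range m, phin τ ψn (i + 1) :=
    psi_tele hτ.ne' ψn
  have hcast : ∀ i : ℕ, t₀ + ((i : ℝ) + 1) * τ = t₀ + ((i + 1 : ℕ) : ℝ) * τ := by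
    intro i; push_cast; ring
  have hτn : ‖(τ : ℂ)‖ = τ := by
    rw [Complex.norm_real, Real.norm_eq_abs, abs_of_pos hτ]
  have hsumb : ∀ (f : ℕ → Coef d) (B : ℝ), (∀ i, Sup K (f i)) → 0 ≤ B → ∀ m ≤ n,
      (∀ i < m, sobNorm s (f i) ≤ B) →
      sobNorm s ((τ : ℂ) • ∑ i ∈ Finset.range m, f i) ≤ T * B := by
    intro f B hf hB m hm hb
    rw [sobNorm_smul, hτn]
    have h1 := sobNorm_sum_le s (Finset.range m) f hf
    have h2 : ∑ i ∈ Finset.range m, sobNorm s (f i) ≤ m * B := by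
      refine (Finset.sum_le_sum fun i hi => hb i (Finset.mem_range.mp hi)).trans ?_
      simp
    calc τ * _ ≤ τ * (m * B) := mul_le_mul_of_nonneg_left (h1.trans h2) hτ.le
      _ = (m * τ) * B := by ring
      _ ≤ T * B := mul_le_mul_of_nonneg_right (hmT m hm) hB
  set A := C₀ + T * (2 * C₀ * M) with hA
  have hA0 : 0 ≤ A := by positivity
  have hδ : ∀ m ≤ n, sobNorm s (psiIhat d K τ t₀ ψK uK m - ψn m) ≤ T * ε := by
    intro m hm
    have e : psiIhat d K τ t₀ ψK uK m - ψn m = (τ : ℂ) • ∑ i ∈ Finset.range m,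
        (phiK d K ψK uK (t₀ + ((i + 1 : ℕ) : ℝ) * τ) - phin τ ψn (i + 1)) := by
      rw [htele m, psiIhat, h00, Finset.sum_sub_distrib, smul_sub]
      simp_rw [hcast]
      abel
    rw [e]
    exact hsumb _ _ (fun i => (sφK _).sub (sφn _)) hε0 m hm
      fun i hi => hφe (i + 1) (by omega) (by omega)
  have hIb : ∀ m ≤ n, sobNorm s (psiIhat d K τ t₀ ψK uK m) ≤ A := by
    intro m hm
    have h1 := sobNorm_add_le s (sψK t₀) ((Sup.sum (Finset.range m)
      (fun i : ℕ => phiK d K ψK uK (t₀ + ((i : ℝ) + 1) * τ)) fun i _ => sφK _).smul (τ : ℂ))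
    have h2 := hsumb (fun i : ℕ => phiK d K ψK uK (t₀ + ((i : ℝ) + 1) * τ)) C₀
      (fun i => sφK _) hC0 m hm (fun i hi => by
        have h3 := hmT (i + 1) (by omega)
        have h4 : 0 ≤ ((i + 1 : ℕ) : ℝ) * τ := by positivity
        simp only [hcast]
        exact hφb _ (by linarith) (by linarith))
    have h5 : T * C₀ ≤ T * (2 * C₀ * M) := by
      apply mul_le_mul_of_nonneg_left _ hT.le
      nlinarith
    unfold psiIhat
    linarith
  have hψb : ∀ m ≤ n, sobNorm s (ψn m) ≤ A := by
    intro m hm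
    have h1 := sobNorm_add_le s (sψn 0) ((Sup.sum (Finset.range m)
      (fun i : ℕ => phin τ ψn (i + 1)) fun i _ => sφn _).smul (τ : ℂ))
    have h2 := hsumb (fun i : ℕ => phin τ ψn (i + 1)) (2 * C₀ * M)
      (fun i => sφn _) (by positivity) m hm (fun i hi => by
        have h3 := hap (i + 1) (by omega) (hmT (i + 1) (by omega))
        have h4 := pairNorm_nonneg s (un (i + 1)) (udn (i + 1))
        linarith)
    rw [htele m]
    rw [h00] at hψ0
    linarith
  have hb0 := bC_nonneg d s
  have hn1 : n - 1 ≤ n := Nat.sub_le _ _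
  constructor
  · -- the `v` estimate
    have e : vhat d K τ t₀ ψK uK udK n - vn d K τ ψn un udn n =
        (sincOp τ (uK (t₀ + (n : ℝ) * τ) - un n)
          - ((τ / 2 : ℝ) : ℂ) • sincHalfSqOp τ (udK (t₀ + (n : ℝ) * τ) - udn n))
        + sincm1Op τ (interp d K (absSq (psiIhat d K τ t₀ ψK uK (n - 1)))
            - interp d K (absSq (ψn (n - 1)))) := by
      simp only [vhat, vn, vNew, sincOp, sincHalfSqOp, sincm1Op, mulOp_sub, smul_sub]
      abel
    rw [e]
    have sa := (suK (t₀ + (n : ℝ) * τ)).sub (sun n)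
    have sb := (sudK (t₀ + (n : ℝ) * τ)).sub (sudn n)
    have sq := (sI (absSq (psiIhat d K τ t₀ ψK uK (n - 1)))).sub (sI (absSq (ψn (n - 1))))
    have h1 := sobNorm_add_le s ((sa.mulOp (fun x => ((sinc (τ * x) : ℝ) : ℂ))).sub
      ((sb.mulOp (fun x => ((sinc (τ * x / 2) ^ 2 : ℝ) : ℂ))).smul ((τ / 2 : ℝ) : ℂ)))
      (sq.mulOp (fun x => ((sinc (τ * x) - 1 : ℝ) : ℂ)))
    have h2 := sobNorm_sub_le s (sa.mulOp (fun x => ((sinc (τ * x) : ℝ) : ℂ)))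
      ((sb.mulOp (fun x => ((sinc (τ * x / 2) ^ 2 : ℝ) : ℂ))).smul ((τ / 2 : ℝ) : ℂ))
    rw [sobNorm_smul, Complex.norm_real, Real.norm_eq_abs, abs_of_pos (by positivity)] at h2
    have h3 := sob_sincOp s τ sa
    have h4 := sob_sincHalfSqOp s τ sb
    have h5 := sob_sincm1Op s τ sq
    have h6 := sob_interp_diff hd hs (sI2 (n - 1)) (sψn (n - 1)) (sI2 (n - 1)) (sψn (n - 1))
    have h7 : sobNorm s (psiIhat d K τ t₀ ψK uK (n - 1) - ψn (n - 1))
          * sobNorm s (psiIhat d K τ t₀ ψK uK (n - 1))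
        + sobNorm s (ψn (n - 1)) * sobNorm s (psiIhat d K τ t₀ ψK uK (n - 1) - ψn (n - 1))
        ≤ T * ε * A + A * (T * ε) :=
      add_le_add
        (mul_le_mul (hδ _ hn1) (hIb _ hn1) (sobNorm_nonneg _ _) (by positivity))
        (mul_le_mul (hψb _ hn1) (hδ _ hn1) (sobNorm_nonneg _ _) hA0)
    have h8 := h6.trans (mul_le_mul_of_nonneg_left h7 hb0)
    have h9 : τ / 2 * sobNorm s (sincHalfSqOp τ (udK (t₀ + (n : ℝ) * τ) - udn n)) ≤ T / 2 * ε :=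
      mul_le_mul (by linarith) (h4.trans hude) (sobNorm_nonneg _ _) (by positivity)
    have h10 : 0 ≤ 2 * bC d s * (2 * T * C₀ + 2 * A) * ε := by positivity
    refine h1.trans ((add_le_add (h2.trans (add_le_add (h3.trans hue) h9))
      (h5.trans (mul_le_mul_of_nonneg_left h8 zero_le_two))).trans ?_)
    linarith
  · -- the `w` estimate
    have e : what d K τ t₀ ψK uK udK n - wn d K τ ψn un udn n =
        sincHalfSqOp τ (udK (t₀ + (n : ℝ) * τ) - udn n)
        + sincm1Op τ (interp d K (reC (conv (psiIhat d K τ t₀ ψK uK n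
              + psiIhat d K τ t₀ ψK uK (n - 1)) (conjC (phiK d K ψK uK (t₀ + (n : ℝ) * τ)))))
            - interp d K (reC (conv (ψn n + ψn (n - 1)) (conjC (phin τ ψn n))))) := by
      simp only [what, wn, wNew, sincHalfSqOp, sincm1Op, mulOp_sub]
      abel
    rw [e]
    have sb := (sudK (t₀ + (n : ℝ) * τ)).sub (sudn n)
    have sp := (sI2 n).add (sI2 (n - 1))
    have sp' := (sψn n).add (sψn (n - 1))
    have sq := (sI (reC (conv (psiIhat d K τ t₀ ψK uK n
              + psiIhat d K τ t₀ ψK uK (n - 1)) (conjC (phiK d K ψK uK (t₀ + (n : ℝ) * τ)))))).sub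
            (sI (reC (conv (ψn n + ψn (n - 1)) (conjC (phin τ ψn n)))))
    have h1 := sobNorm_add_le s (sb.mulOp (fun x => ((sinc (τ * x / 2) ^ 2 : ℝ) : ℂ)))
      (sq.mulOp (fun x => ((sinc (τ * x) - 1 : ℝ) : ℂ)))
    have h4 := sob_sincHalfSqOp s τ sb
    have h5 := sob_sincm1Op s τ sq
    have h6 := sob_interp_re_diff hd hs sp sp' (sφK (t₀ + (n : ℝ) * τ)) (sφn n)
    have hp : sobNorm s (psiIhat d K τ t₀ ψK uK n + psiIhat d K τ t₀ ψK uK (n - 1)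
        - (ψn n + ψn (n - 1))) ≤ 2 * T * ε := by
      rw [add_sub_add_comm]
      have := sobNorm_add_le s ((sI2 n).sub (sψn n)) ((sI2 (n - 1)).sub (sψn (n - 1)))
      have := hδ n le_rfl
      have := hδ (n - 1) hn1
      linarith
    have hp' : sobNorm s (ψn n + ψn (n - 1)) ≤ 2 * A := by
      have := sobNorm_add_le s (sψn n) (sψn (n - 1))
      have := hψb n le_rfl
      have := hψb (n - 1) hn1
      linarith
    have hφ1 : sobNorm s (phiK d K ψK uK (t₀ + (n : ℝ) * τ)) ≤ C₀ := by
      have : 0 ≤ (n : ℝ) * τ := by positivity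
      exact hφb _ (by linarith) (by linarith)
    have h7 := add_le_add (mul_le_mul hp hφ1 (sobNorm_nonneg _ _) (by positivity))
        (mul_le_mul hp' (hφe n hn le_rfl) (sobNorm_nonneg _ _) (by positivity))
    have h8 := h6.trans (mul_le_mul_of_nonneg_left h7 hb0)
    have h10 : 0 ≤ 2 * bC d s * (2 * T * A) * ε := by positivity
    have h11 : 0 ≤ T / 2 * ε := by positivity
    refine h1.trans ((add_le_add (h4.trans hude)
      (h5.trans (mul_le_mul_of_nonneg_left h8 zero_le_two))).trans ?_)
    linarith

end Zak
end
end
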